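/- Fix r ≥ 1 and let A = F_p[y^{1/p^∞}]/(y). The ring homomorphism (Z/p^r)[M] → W_r(A) sending the monoid-algebra basis element y^q to the Teichmüller representative [ȳ^q] induces a ring isomorphism W_r(F_p[y^{1/p^∞}]/(y)) ≅ (Z/p^r)[y^{1/p^∞}] / (y, p·y^{1/p}, p^2·y^{1/p^2}, …, p^{r−1}·y^{1/p^{r−1}}), i.e. its kernel is exactly the ideal of (Z/p^r)[M] generated by the elements p^k · y^{1/p^k} for 0 ≤ k ≤ r−1. -/

import Mathlib

/-- The additive monoid `M = ℤ[1/p]_{≥ 0}` of nonnegative rational numbers whose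
denominator is a power of `p`, realized as an additive submonoid of `ℚ`. -/
def Mp (p : ℕ) : AddSubmonoid ℚ where
  carrier := {q | 0 ≤ q ∧ ∃ (k : ℕ) (m : ℤ), q * (p : ℚ) ^ k = m}
  zero_mem' := ⟨le_refl 0, 0, 0, by norm_num⟩
  add_mem' := by
    rintro a b ⟨ha, k, m, hm⟩ ⟨hb, l, n, hn⟩
    refine ⟨add_nonneg ha hb, k + l, m * (p : ℤ) ^ l + n * (p : ℤ) ^ k, ?_⟩
    push_cast
    calc (a + b) * (p : ℚ) ^ (k + l)
        = (a * (p : ℚ) ^ k) * (p : ℚ) ^ l + (b * (p : ℚ) ^ l) * (p : ℚ) ^ k := by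
          rw [pow_add]; ring
      _ = (m : ℚ) * (p : ℚ) ^ l + (n : ℚ) * (p : ℚ) ^ k := by rw [hm, hn]

/-- `F_p[y^{1/p^∞}]`, the monoid algebra of `M` over `F_p = ZMod p`. -/
abbrev Rp (p : ℕ) : Type := AddMonoidAlgebra (ZMod p) (Mp p)

/-- The basis element `y^q` of `F_p[y^{1/p^∞}]`, for `q ∈ M`. -/
noncomputable def ye (p : ℕ) (q : Mp p) : Rp p := AddMonoidAlgebra.single q 1

/-- `1 ∈ M`. -/
def oneM (p : ℕ) : Mp p := ⟨1, zero_le_one, 0, 1, by norm_num⟩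

/-- `1/p^k ∈ M`. -/
def pinvM (p : ℕ) (hp : p ≠ 0) (k : ℕ) : Mp p :=
  ⟨1 / (p : ℚ) ^ k, by positivity, k, 1, by
    have hp' : (p : ℚ) ≠ 0 := Nat.cast_ne_zero.mpr hp
    field_simp
    simp⟩

/-- The quotient ring `A = F_p[y^{1/p^∞}]/(y)`. -/
abbrev Ap (p : ℕ) : Type := Rp p ⧸ Ideal.span {ye p (oneM p)}

/-- The class `ȳ^q` of the basis element `y^q` in `A = F_p[y^{1/p^∞}]/(y)`. -/
noncomputable def ybar (p : ℕ) (q : Mp p) : Ap p :=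
  Ideal.Quotient.mk (Ideal.span {ye p (oneM p)}) (ye p q)

namespace TruncatedWittVector

variable {p : ℕ} [Fact p.Prime] {n : ℕ} {R : Type*} [CommRing R]

/-- The zeroth coefficient as a ring homomorphism. -/
noncomputable def coeffZeroHom (p : ℕ) [Fact p.Prime] {n : ℕ} (R : Type*) [CommRing R]
    (hn : 0 < n) : TruncatedWittVector p n R →+* R where
  toFun x := x.coeff ⟨0, hn⟩
  map_zero' := coeff_zero p n R _
  map_one' := by
    rw [← map_one (WittVector.truncate n), WittVector.coeff_truncate, WittVector.one_coeff_zero]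
  map_add' x y := by
    obtain ⟨x, rfl⟩ := WittVector.truncate_surjective p n R x
    obtain ⟨y, rfl⟩ := WittVector.truncate_surjective p n R y
    simp only [← map_add, WittVector.coeff_truncate, WittVector.add_coeff_zero]
  map_mul' x y := by
    obtain ⟨x, rfl⟩ := WittVector.truncate_surjective p n R x
    obtain ⟨y, rfl⟩ := WittVector.truncate_surjective p n R y
    simp only [← map_mul, WittVector.coeff_truncate, WittVector.mul_coeff_zero]

theorem coeffZeroHom_truncate_teichmuller (hn : 0 < n) (a : R) :
    coeffZeroHom p R hn (WittVector.truncate n (WittVector.teichmuller p a)) = a := by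
  change coeff ⟨0, hn⟩ (WittVector.truncate n (WittVector.teichmuller p a)) = a
  rw [WittVector.coeff_truncate, WittVector.teichmuller_coeff_zero]

theorem mul_p_pow_coeff_of_lt [CharP R p] (x : TruncatedWittVector p n R) {k : ℕ} (i : Fin n)
    (hi : (i : ℕ) < k) : (x * (p : TruncatedWittVector p n R) ^ k).coeff i = 0 := by
  obtain ⟨x, rfl⟩ := WittVector.truncate_surjective p n R x
  rw [← map_natCast (WittVector.truncate n), ← map_pow, ← map_mul, WittVector.coeff_truncate,
    WittVector.mul_pow_charP_coeff_zero x hi]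

theorem mul_p_pow_coeff_self [CharP R p] (x : TruncatedWittVector p n R) {k : ℕ} (hk : k < n) :
    (x * (p : TruncatedWittVector p n R) ^ k).coeff ⟨k, hk⟩ =
      coeffZeroHom p R (Nat.zero_lt_of_lt hk) x ^ p ^ k := by
  obtain ⟨x, rfl⟩ := WittVector.truncate_surjective p n R x
  rw [← map_natCast (WittVector.truncate n), ← map_pow, ← map_mul, WittVector.coeff_truncate]
  have := WittVector.mul_pow_charP_coeff_succ x (m := 0) (n := k)
  rw [zero_add] at this
  exact this.trans (congrArg (· ^ p ^ k) (WittVector.coeff_truncate x ⟨0, _⟩).symm)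

theorem p_pow_eq_zero [CharP R p] : (p : TruncatedWittVector p n R) ^ n = 0 := by
  ext i
  rw [← one_mul ((p : TruncatedWittVector p n R) ^ n), mul_p_pow_coeff_of_lt _ _ i.2, coeff_zero]

/-- If `a ^ p ^ k = 0`, then `p ^ k` kills the Teichmüller representative of `a`. -/
theorem truncate_teichmuller_mul_p_pow_eq_zero [CharP R p] {a : R} {k : ℕ} (ha : a ^ p ^ k = 0) :
    WittVector.truncate n (WittVector.teichmuller p a) * (p : TruncatedWittVector p n R) ^ k
      = 0 := by
  rw [← map_natCast (WittVector.truncate n), ← map_pow, ← map_mul]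
  ext i
  rw [WittVector.coeff_truncate, coeff_zero]
  rcases lt_or_ge (i : ℕ) k with h | h
  · exact WittVector.mul_pow_charP_coeff_zero _ h
  · obtain ⟨m, hm⟩ := Nat.exists_eq_add_of_le' h
    rw [hm, WittVector.mul_pow_charP_coeff_succ]
    rcases Nat.eq_zero_or_pos m with rfl | hpos
    · rw [WittVector.teichmuller_coeff_zero, ha]
    · rw [WittVector.teichmuller_coeff_pos p a m hpos,
        zero_pow (pow_ne_zero _ (Fact.out : p.Prime).ne_zero)]

/-- A ring homomorphism to truncated Witt vectors is surjective as soon as the `p ^ k`-th powers of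
the zeroth coefficients of its image exhaust the base ring. -/
theorem surjective_of_exists_pow_eq [CharP R p] {S : Type*} [CommRing S] (hn : 0 < n)
    (f : S →+* TruncatedWittVector p n R)
    (hf : ∀ (k : ℕ) (a : R), ∃ z, coeffZeroHom p R hn (f z) ^ p ^ k = a) :
    Function.Surjective f := by
  intro w
  suffices H : ∀ k, ∀ hk : k ≤ n, ∃ x, truncate hk (f x) = truncate hk w by
    obtain ⟨x, hx⟩ := H n le_rfl
    refine ⟨x, ext fun i => ?_⟩
    have := congrArg (coeff i) hx
    rwa [coeff_truncate, coeff_truncate] at this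
  intro k
  induction k with
  | zero => exact fun hk => ⟨0, ext fun i => i.elim0⟩
  | succ k ih =>
    intro hk
    obtain ⟨x, hx⟩ := ih (by omega)
    obtain ⟨z, hz⟩ := hf k ((w - f x).coeff ⟨k, hk⟩)
    have hd : truncate (Nat.le_of_succ_le hk) (w - f x) = 0 := by rw [map_sub, hx, sub_self]
    have key : truncate hk (f z * (p : TruncatedWittVector p n R) ^ k) =
        truncate hk (w - f x) := by
      ext i
      rw [coeff_truncate, coeff_truncate]
      rcases (Nat.lt_succ_iff.mp i.2).lt_or_eq with h | h
      · rw [mul_p_pow_coeff_of_lt _ (Fin.castLE hk i) h]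
        have := congrArg (coeff ⟨i, h⟩) hd
        rw [coeff_truncate, coeff_zero] at this
        exact this.symm
      · have hi : Fin.castLE hk i = ⟨k, hk⟩ := Fin.ext h
        rw [hi, mul_p_pow_coeff_self _ hk, hz]
    refine ⟨x + z * (p : S) ^ k, ?_⟩
    rw [map_add f, map_mul f, map_pow f, map_natCast, map_add, key, map_sub, add_sub_cancel]

end TruncatedWittVector

section Perfection

variable {p : ℕ}

theorem Mp.exists_add_eq {a b : Mp p} (h : (a : ℚ) ≤ b) : ∃ d : Mp p, b = d + a := by
  obtain ⟨a, ha, k, m, hm⟩ := a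
  obtain ⟨b, hb, l, n, hn⟩ := b
  refine ⟨⟨b - a, sub_nonneg.mpr h, k + l, n * (p : ℤ) ^ k - m * (p : ℤ) ^ l, ?_⟩,
    Subtype.ext (sub_add_cancel b a).symm⟩
  push_cast
  rw [← hm, ← hn, pow_add]
  ring

theorem ybar_add (a b : Mp p) : ybar p (a + b) = ybar p a * ybar p b := by
  have h : ye p (a + b) = ye p a * ye p b := by simp [ye]
  rw [ybar, h, map_mul, ybar, ybar]

theorem ybar_zero : ybar p 0 = 1 := map_one (Ideal.Quotient.mk _)

theorem ybar_nsmul (n : ℕ) (a : Mp p) : ybar p (n • a) = ybar p a ^ n := by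
  have h : ye p (n • a) = ye p a ^ n := by simp [ye]
  rw [ybar, h, map_pow, ybar]

theorem ybar_one : ybar p (oneM p) = 0 :=
  Ideal.Quotient.eq_zero_iff_mem.mpr (Ideal.mem_span_singleton_self _)

/-- The reduction `(ℤ/p^r)[M] → F_p[M]`. -/
noncomputable def reduction (p : ℕ) {r : ℕ} (hr : 1 ≤ r) :
    AddMonoidAlgebra (ZMod (p ^ r)) (Mp p) →+* Rp p :=
  AddMonoidAlgebra.mapRingHom (Mp p) (ZMod.castHom (dvd_pow_self p (by omega)) (ZMod p))

theorem reduction_surjective {r : ℕ} (hr : 1 ≤ r) : Function.Surjective (reduction p hr) := by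
  intro f
  induction f using AddMonoidAlgebra.induction_linear with
  | zero => exact ⟨0, map_zero _⟩
  | add x y hx hy =>
    obtain ⟨a, rfl⟩ := hx
    obtain ⟨b, rfl⟩ := hy
    exact ⟨a + b, map_add _ a b⟩
  | single m c =>
    obtain ⟨c, rfl⟩ := ZMod.castHom_surjective (dvd_pow_self p (by omega : r ≠ 0)) c
    exact ⟨.single m c, AddMonoidAlgebra.mapRingHom_single _ _ _⟩

variable [hp : Fact p.Prime]

theorem Mp.exists_nsmul_eq (k : ℕ) (q : Mp p) : ∃ q' : Mp p, p ^ k • q' = q := by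
  obtain ⟨q, h0, l, m, hm⟩ := q
  have hp0 : (p : ℚ) ≠ 0 := Nat.cast_ne_zero.mpr hp.out.ne_zero
  refine ⟨⟨q / (p : ℚ) ^ k, by positivity, l + k, m, ?_⟩, Subtype.ext ?_⟩
  · rw [← hm, pow_add]
    field_simp
  · simp only [AddSubmonoidClass.coe_nsmul, nsmul_eq_mul, Nat.cast_pow]
    field_simp

theorem Mp.nsmul_injective (k : ℕ) : Function.Injective fun q : Mp p => p ^ k • q := by
  intro a b h
  have := congrArg Subtype.val h
  simp only [AddSubmonoidClass.coe_nsmul] at this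
  exact Subtype.ext (nsmul_right_injective (pow_ne_zero k hp.out.ne_zero) this)

theorem nsmul_pinvM (k : ℕ) : p ^ k • pinvM p hp.out.ne_zero k = oneM p := by
  have hp0 : (p : ℚ) ≠ 0 := Nat.cast_ne_zero.mpr hp.out.ne_zero
  apply Subtype.ext
  simp only [AddSubmonoidClass.coe_nsmul, nsmul_eq_mul, Nat.cast_pow, pinvM, oneM]
  field_simp

theorem mem_span_ye_one_iff (f : Rp p) :
    f ∈ Ideal.span {ye p (oneM p)} ↔ ∀ q : Mp p, (q : ℚ) < 1 → f.coeff q = 0 := by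
  have h := AddMonoidAlgebra.mem_ideal_span_of'_image (k := ZMod p) (s := {oneM p}) (x := f)
  rw [Set.image_singleton] at h
  refine h.trans ⟨fun H q hq => ?_, fun H q hq => ⟨_, rfl, Mp.exists_add_eq ?_⟩⟩
  · by_contra hne
    obtain ⟨_, rfl, d, rfl⟩ := H q (Finsupp.mem_support_iff.mpr hne)
    have hd : (0 : ℚ) ≤ d := d.2.1
    simp only [AddSubmonoid.coe_add, oneM] at hq
    linarith
  · by_contra hlt
    exact Finsupp.mem_support_iff.mp hq (H q (not_le.mp hlt))

instance Ap.nontrivial : Nontrivial (Ap p) := by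
  refine Ideal.Quotient.nontrivial_iff.mpr fun h => ?_
  have := (mem_span_ye_one_iff (p := p) 1).mp (h ▸ Submodule.mem_top) 0 (by simp)
  simp [AddMonoidAlgebra.one_def] at this

instance Rp.charP : CharP (Rp p) p :=
  charP_of_injective_algebraMap (algebraMap (ZMod p) (Rp p)).injective p

instance Ap.charP : CharP (Ap p) p :=
  charP_of_injective_algebraMap (algebraMap (ZMod p) (Ap p)).injective p

theorem Rp.coeff_pow (f : Rp p) (k : ℕ) (q : Mp p) :
    (f ^ p ^ k).coeff (p ^ k • q) = f.coeff q := by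
  have h : iterateFrobenius (Rp p) p k =
      AddMonoidAlgebra.mapDomainRingHom (ZMod p) (nsmulAddMonoidHom (α := Mp p) (p ^ k)) := by
    refine AddMonoidAlgebra.ringHom_ext (fun r => ?_) (fun m => ?_) <;>
      simp [iterateFrobenius_def, AddMonoidAlgebra.single_pow, ZMod.pow_card_pow]
  rw [← iterateFrobenius_def, h]
  exact Finsupp.mapDomain_apply (Mp.nsmul_injective k) f.coeff q

theorem Rp.exists_pow_eq (k : ℕ) (f : Rp p) : ∃ g : Rp p, g ^ p ^ k = f := by
  induction f using AddMonoidAlgebra.induction_linear with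
  | zero => exact ⟨0, zero_pow (pow_ne_zero _ hp.out.ne_zero)⟩
  | add x y hx hy =>
    obtain ⟨a, rfl⟩ := hx
    obtain ⟨b, rfl⟩ := hy
    exact ⟨a + b, add_pow_char_pow a b p k⟩
  | single m c =>
    obtain ⟨m, rfl⟩ := Mp.exists_nsmul_eq k m
    exact ⟨.single m c, by rw [AddMonoidAlgebra.single_pow, ZMod.pow_card_pow]⟩

/-- The multiplicative map `q ↦ [ȳ^q]` to truncated Witt vectors. -/
noncomputable def teichmullerYbar (p : ℕ) [Fact p.Prime] (r : ℕ) :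
    Multiplicative (Mp p) →* TruncatedWittVector p r (Ap p) where
  toFun q := WittVector.truncate r (WittVector.teichmuller p (ybar p q.toAdd))
  map_one' := by rw [toAdd_one, ybar_zero, map_one, map_one]
  map_mul' a b := by rw [toAdd_mul, ybar_add, map_mul, map_mul]

theorem nonempty_zmod_ringHom (r : ℕ) :
    Nonempty (ZMod (p ^ r) →+* TruncatedWittVector p r (Ap p)) := by
  obtain ⟨m, hm⟩ := CharP.exists (TruncatedWittVector p r (Ap p))
  have hdvd : m ∣ p ^ r := (CharP.cast_eq_zero_iff (TruncatedWittVector p r (Ap p)) m _).mp (by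
    rw [Nat.cast_pow, TruncatedWittVector.p_pow_eq_zero])
  exact ⟨ZMod.castHom hdvd _⟩

theorem ZMod.p_dvd_of_castHom_eq_zero {r : ℕ} (hr : 1 ≤ r) {c : ZMod (p ^ r)}
    (hc : ZMod.castHom (dvd_pow_self p (by omega : r ≠ 0)) (ZMod p) c = 0) :
    (p : ZMod (p ^ r)) ∣ c := by
  obtain ⟨n, rfl⟩ := ZMod.natCast_zmod_surjective c
  rw [map_natCast, ZMod.natCast_eq_zero_iff] at hc
  exact_mod_cast Nat.cast_dvd_cast hc

theorem coeffZeroHom_comp_eq {r : ℕ} (hr : 1 ≤ r)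
    (θ : AddMonoidAlgebra (ZMod (p ^ r)) (Mp p) →+* TruncatedWittVector p r (Ap p))
    (hθ : ∀ q : Mp p, θ (.single q 1) =
      WittVector.truncate r (WittVector.teichmuller p (ybar p q))) :
    (TruncatedWittVector.coeffZeroHom p (Ap p) hr).comp θ =
      (Ideal.Quotient.mk (Ideal.span {ye p (oneM p)})).comp (reduction p hr) := by
  refine AddMonoidAlgebra.ringHom_ext' (Subsingleton.elim _ _) (MonoidHom.ext fun q => ?_)
  change TruncatedWittVector.coeffZeroHom p (Ap p) hr (θ (.single q.toAdd 1)) =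
    Ideal.Quotient.mk _ (reduction p hr (.single q.toAdd 1))
  rw [hθ, TruncatedWittVector.coeffZeroHom_truncate_teichmuller, reduction,
    AddMonoidAlgebra.mapRingHom_single, map_one]
  rfl

/-- The ideal `(y, p y^{1/p}, …, p^{r-1} y^{1/p^{r-1}})`. -/
noncomputable abbrev kerIdeal (p : ℕ) [hp : Fact p.Prime] (r : ℕ) :
    Ideal (AddMonoidAlgebra (ZMod (p ^ r)) (Mp p)) :=
  Ideal.span (Set.range fun k : Fin r =>
    (p : AddMonoidAlgebra (ZMod (p ^ r)) (Mp p)) ^ (k : ℕ) *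
      AddMonoidAlgebra.single (pinvM p hp.out.ne_zero (k : ℕ)) 1)

theorem p_pow_mul_mem {r k : ℕ} (hr : 1 ≤ r) (hk : k < r)
    {z : AddMonoidAlgebra (ZMod (p ^ r)) (Mp p)}
    (hz : reduction p hr z ^ p ^ k ∈ Ideal.span {ye p (oneM p)}) :
    (p : AddMonoidAlgebra (ZMod (p ^ r)) (Mp p)) ^ k * z ∈
      kerIdeal p r ⊔ Ideal.span {(p : AddMonoidAlgebra (ZMod (p ^ r)) (Mp p)) ^ (k + 1)} := by
  rw [mem_span_ye_one_iff] at hz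
  rw [← z.sum_coeff_single, Finsupp.sum, Finset.mul_sum]
  refine Ideal.sum_mem _ fun q _ => ?_
  have hpos : (0 : ℚ) < (p : ℚ) ^ k := pow_pos (Nat.cast_pos.mpr hp.out.pos) k
  rcases lt_or_ge (q : ℚ) (1 / (p : ℚ) ^ k) with hq | hq
  · have h0 := hz (p ^ k • q) (by
      rw [lt_div_iff₀ hpos] at hq
      simpa [mul_comm] using hq)
    rw [Rp.coeff_pow, reduction, AddMonoidAlgebra.coeff_mapRingHom] at h0
    obtain ⟨c, hc⟩ := ZMod.p_dvd_of_castHom_eq_zero hr h0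
    refine Ideal.mem_sup_right (Ideal.mem_span_singleton.mpr ⟨.single q c, ?_⟩)
    rw [hc, pow_succ, mul_assoc, AddMonoidAlgebra.natCast_def,
      AddMonoidAlgebra.single_mul_single, zero_add]
  · obtain ⟨d, hd⟩ := Mp.exists_add_eq (a := pinvM p hp.out.ne_zero k) hq
    have : (AddMonoidAlgebra.single q (z.coeff q) : AddMonoidAlgebra (ZMod (p ^ r)) (Mp p)) =
        .single (pinvM p hp.out.ne_zero k) 1 * .single d (z.coeff q) := by
      rw [AddMonoidAlgebra.single_mul_single, one_mul, hd, add_comm]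
    rw [this, ← mul_assoc]
    exact Ideal.mem_sup_left (Ideal.mul_mem_right _ _ (Ideal.subset_span ⟨⟨k, hk⟩, rfl⟩))

theorem kerIdeal_le_ker {r : ℕ}
    (θ : AddMonoidAlgebra (ZMod (p ^ r)) (Mp p) →+* TruncatedWittVector p r (Ap p))
    (hθ : ∀ q : Mp p, θ (.single q 1) =
      WittVector.truncate r (WittVector.teichmuller p (ybar p q))) :
    kerIdeal p r ≤ RingHom.ker θ := by
  rw [Ideal.span_le]
  rintro _ ⟨k, rfl⟩
  change θ _ = 0
  rw [map_mul, hθ, map_pow, map_natCast, mul_comm,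
    TruncatedWittVector.truncate_teichmuller_mul_p_pow_eq_zero]
  rw [← ybar_nsmul, nsmul_pinvM, ybar_one]

theorem ker_le_kerIdeal {r : ℕ} (hr : 1 ≤ r)
    (θ : AddMonoidAlgebra (ZMod (p ^ r)) (Mp p) →+* TruncatedWittVector p r (Ap p))
    (hθ : ∀ q : Mp p, θ (.single q 1) =
      WittVector.truncate r (WittVector.teichmuller p (ybar p q))) :
    RingHom.ker θ ≤ kerIdeal p r := by
  have H : ∀ k ≤ r, RingHom.ker θ ≤
      kerIdeal p r ⊔ Ideal.span {(p : AddMonoidAlgebra (ZMod (p ^ r)) (Mp p)) ^ k} := by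
    intro k
    induction k with
    | zero => simp
    | succ k ih =>
      intro hk x hx
      obtain ⟨j, hj, w, hw, rfl⟩ := Submodule.mem_sup.mp (ih (by omega) hx)
      obtain ⟨z, rfl⟩ := Ideal.mem_span_singleton.mp hw
      refine Ideal.add_mem _ (Ideal.mem_sup_left hj) (p_pow_mul_mem hr hk ?_)
      have hz : θ z * (p : TruncatedWittVector p r (Ap p)) ^ k = 0 := by
        have hj0 : θ j = 0 := kerIdeal_le_ker θ hθ hj
        have hx0 : θ (j + _) = 0 := hx
        rwa [map_add, hj0, zero_add, map_mul, map_pow, map_natCast, mul_comm] at hx0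
      have hc := TruncatedWittVector.mul_p_pow_coeff_self (θ z) hk
      rw [hz, TruncatedWittVector.coeff_zero] at hc
      have hcomp := RingHom.congr_fun (coeffZeroHom_comp_eq hr θ hθ) z
      rw [RingHom.comp_apply, RingHom.comp_apply] at hcomp
      rw [← Ideal.Quotient.eq_zero_iff_mem, map_pow, ← hcomp, ← hc]
  have hp0 : (p : AddMonoidAlgebra (ZMod (p ^ r)) (Mp p)) ^ r = 0 := by
    rw [← Nat.cast_pow, AddMonoidAlgebra.natCast_def, ZMod.natCast_self,
      AddMonoidAlgebra.single_zero]
  simpa [hp0] using H r le_rfl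

end Perfection

/-- for `r ≥ 1` and `A = F_p[y^{1/p^∞}]/(y)`, the ring homomorphism
`θ : (ℤ/p^r)[M] → W_r(A)`, `y^q ↦ [ȳ^q]`, is surjective with kernel exactly the ideal
generated by the elements `p^k · y^{1/p^k}` for `0 ≤ k ≤ r−1`; that is, it induces a
ring isomorphism
`W_r(F_p[y^{1/p^∞}]/(y)) ≅ (ℤ/p^r)[y^{1/p^∞}]/(y, p·y^{1/p}, …, p^{r−1}·y^{1/p^{r−1}})`. -/
theorem statement9 (p : ℕ) [hp : Fact p.Prime] (r : ℕ) (hr : 1 ≤ r) :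
    ∃ θ : AddMonoidAlgebra (ZMod (p ^ r)) (Mp p) →+* TruncatedWittVector p r (Ap p),
      (∀ q : Mp p, θ (AddMonoidAlgebra.single q 1)
          = WittVector.truncate r (WittVector.teichmuller p (ybar p q))) ∧
      Function.Surjective θ ∧
      RingHom.ker θ = Ideal.span (Set.range fun k : Fin r =>
        (p : AddMonoidAlgebra (ZMod (p ^ r)) (Mp p)) ^ (k : ℕ) *
          AddMonoidAlgebra.single (pinvM p hp.out.ne_zero (k : ℕ)) 1) := by
  obtain ⟨i⟩ := nonempty_zmod_ringHom (p := p) r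
  let θ := AddMonoidAlgebra.liftNCRingHom i (teichmullerYbar p r) fun _ _ => Commute.all _ _
  have hθ : ∀ q : Mp p, θ (AddMonoidAlgebra.single q 1)
      = WittVector.truncate r (WittVector.teichmuller p (ybar p q)) := fun q => by
    rw [AddMonoidAlgebra.liftNCRingHom_single, map_one, one_mul]
    rfl
  refine ⟨θ, hθ, TruncatedWittVector.surjective_of_exists_pow_eq hr θ fun k a => ?_,
    le_antisymm (ker_le_kerIdeal hr θ hθ) (kerIdeal_le_ker θ hθ)⟩
  obtain ⟨f, rfl⟩ := Ideal.Quotient.mk_surjective a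
  obtain ⟨g, rfl⟩ := Rp.exists_pow_eq k f
  obtain ⟨z, rfl⟩ := reduction_surjective hr g
  refine ⟨z, ?_⟩
  rw [map_pow]
  exact congrArg (· ^ p ^ k) (RingHom.congr_fun (coeffZeroHom_comp_eq hr θ hθ) z)
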